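/- arXiv:1304.7965 — 4 statements merged into one kernel-verified Lean document; each statement's English description precedes it below -/
import Mathlib

section
/- Let g_1, …, g_m be convex polynomials on ℝ^n such that S := {x ∈ ℝ^n : g_i(x) ≤ 0 for all i = 1, …, m} is nonempty and g_i(x) = 0 for every x ∈ S and every i = 1, …, m (equivalently, {x : g_i(x) ≤ 0 ∀i} = {x : g_i(x) = 0 ∀i}). Then there exist α_1, …, α_m ≥ 0 with Σ_{i=1}^m α_i = 1 such that Σ_{i=1}^m α_i·g_i(x) ≥ 0 for all x ∈ ℝ^n. -/
open Metric Set Filter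
open scoped BigOperators

noncomputable section

/-- Gordan's alternative for convex functions: if finitely many convex functions are never
simultaneously negative, then some convex combination of them is nonnegative. -/
theorem ConvexOn.exists_convex_combination_nonneg {E ι : Type*} [AddCommGroup E] [Module ℝ E]
    [Fintype ι] {s : Set E} (hs : s.Nonempty) {g : ι → E → ℝ} (hg : ∀ i, ConvexOn ℝ s (g i))
    (hneg : ∀ x ∈ s, ∃ i, 0 ≤ g i x) :
    ∃ α : ι → ℝ, (∀ i, 0 ≤ α i) ∧ ∑ i, α i = 1 ∧ ∀ x ∈ s, 0 ≤ ∑ i, α i * g i x := by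
  classical
  obtain ⟨x₀, hx₀⟩ := hs
  let C : Set (ι → ℝ) := ⋃ x ∈ s, Set.univ.pi fun i => Ioi (g i x)
  have mem_C {y : ι → ℝ} : y ∈ C ↔ ∃ x ∈ s, ∀ i, g i x < y i := by simp [C, Set.mem_pi]
  have hCo : IsOpen C :=
    isOpen_biUnion fun _ _ => isOpen_set_pi Set.finite_univ fun _ _ => isOpen_Ioi
  have hCc : Convex ℝ C := by
    intro y hy z hz a b ha hb hab
    obtain ⟨u, hu, hyu⟩ := mem_C.1 hy
    obtain ⟨v, hv, hzv⟩ := mem_C.1 hz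
    refine mem_C.2 ⟨a • u + b • v, (hg (hneg u hu).choose).1 hu hv ha hb hab, fun i => ?_⟩
    have h_pos := convex_Ioi (0 : ℝ) (sub_pos.2 (hyu i)) (sub_pos.2 (hzv i)) ha hb hab
    have h_le := (hg i).2 hu hv ha hb hab
    simp only [smul_eq_mul, Set.mem_Ioi, Pi.add_apply, Pi.smul_apply] at h_pos h_le ⊢
    linarith
  have h0 : (0 : ι → ℝ) ∉ C := fun h => by
    obtain ⟨x, hx, hlt⟩ := mem_C.1 h
    obtain ⟨i, hi⟩ := hneg x hx
    exact (hlt i).not_ge hi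
  obtain ⟨f, hf⟩ := geometric_hahn_banach_open_point hCc hCo h0
  have hf_apply (y : ι → ℝ) : f y = ∑ i, y i * f (Pi.single i 1) := by
    conv_lhs => rw [← Finset.univ_sum_single y, map_sum]
    refine Finset.sum_congr rfl fun i _ => ?_
    rw [← smul_eq_mul, ← map_smul, ← Pi.single_smul, smul_eq_mul, mul_one]
  have hf_add {x : E} (hx : x ∈ s) {v : ι → ℝ} (hv : ∀ i, 0 < v i) :
      f (fun i => g i x) + f v < 0 := by
    rw [← map_add, ← map_zero f]
    exact hf _ (mem_C.2 ⟨x, hx, fun i => lt_add_of_pos_right _ (hv i)⟩)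
  have hβ (i : ι) : f (Pi.single i 1) ≤ 0 := by
    by_contra! hi
    obtain ⟨k, hk⟩ := exists_nat_gt
      (-(f (fun j => g j x₀) + f 1) / f (Pi.single i 1))
    rw [div_lt_iff₀ hi] at hk
    have := hf_add hx₀ (v := 1 + (k : ℝ) • Pi.single i 1) fun j => by
      have : (0 : ι → ℝ) ≤ Pi.single i 1 := Pi.single_nonneg.2 zero_le_one
      have : 0 ≤ (Pi.single i 1 : ι → ℝ) j := this j
      simp only [Pi.add_apply, Pi.one_apply, Pi.smul_apply, smul_eq_mul]
      positivity
    rw [map_add, map_smul, smul_eq_mul] at this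
    linarith
  have hfg {x : E} (hx : x ∈ s) : f (fun i => g i x) ≤ 0 := by
    refine le_of_tendsto (f := fun ε : ℝ => f (fun i => g i x) + ε * f 1) (x := nhdsWithin 0 (Ioi 0)) ?_ ?_
    · refine tendsto_nhdsWithin_of_tendsto_nhds ?_
      have : Continuous fun ε : ℝ => f (fun i => g i x) + ε * f 1 := by fun_prop
      simpa using this.tendsto 0
    · filter_upwards [self_mem_nhdsWithin] with ε hε
      have := hf_add hx (v := ε • 1) fun i => by simpa using hε
      rw [map_smul, smul_eq_mul] at this
      exact this.le
  have hsum : ∑ i, f (Pi.single i 1) < 0 := by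
    refine (Finset.sum_nonpos fun i _ => hβ i).lt_of_ne fun h => ?_
    have hz := (Finset.sum_eq_zero_iff_of_nonpos fun i _ => hβ i).1 h
    have hf0 (y : ι → ℝ) : f y = 0 := by
      rw [hf_apply]
      exact Finset.sum_eq_zero fun i hi => by rw [hz i hi, mul_zero]
    have := hf_add hx₀ (v := 1) fun _ => zero_lt_one
    simp [hf0] at this
  refine ⟨fun i => f (Pi.single i 1) / ∑ j, f (Pi.single j 1),
    fun i => div_nonneg_of_nonpos (hβ i) hsum.le, ?_, fun x hx => ?_⟩
  · rw [← Finset.sum_div, div_self hsum.ne]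
  · have : ∑ i, f (Pi.single i 1) / (∑ j, f (Pi.single j 1)) * g i x
        = f (fun i => g i x) / ∑ j, f (Pi.single j 1) := by
      rw [hf_apply, Finset.sum_div]
      exact Finset.sum_congr rfl fun i _ => by ring
    rw [this]
    exact div_nonneg_of_nonpos (hfg hx) hsum.le

/-- Separation: if the solution set of a convex polynomial system consists of common
zeros, then some convex combination of the polynomials is globally nonnegative. -/
theorem convex_combination_nonneg_of_all_active
    (n m : ℕ) (hn : 0 < n) (hm : 0 < m)
    (g : Fin m → EuclideanSpace ℝ (Fin n) → ℝ)
    (hpoly : ∀ i, ∃ p : MvPolynomial (Fin n) ℝ,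
      ∀ x : EuclideanSpace ℝ (Fin n), g i x = MvPolynomial.eval (fun j => x j) p)
    (hconv : ∀ i, ConvexOn ℝ Set.univ (g i))
    (S : Set (EuclideanSpace ℝ (Fin n)))
    (hS : S = {x | ∀ i, g i x ≤ 0}) (hSne : S.Nonempty)
    (hzero : ∀ x ∈ S, ∀ i, g i x = 0) :
    ∃ α : Fin m → ℝ, (∀ i, 0 ≤ α i) ∧ (∑ i, α i = 1) ∧
      ∀ x : EuclideanSpace ℝ (Fin n), 0 ≤ ∑ i, α i * g i x := by
  obtain ⟨α, hα, hα_sum, h⟩ := ConvexOn.exists_convex_combination_nonneg Set.univ_nonempty hconv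
    fun x _ => by
      by_contra! hx
      have hxS : x ∈ S := hS ▸ fun i => (hx i).le
      exact (hx ⟨0, hm⟩).ne (hzero x hxS _)
  exact ⟨α, hα, hα_sum, fun x => h x (Set.mem_univ x)⟩
end
end

section
/- Let d ≥ 2 be an even integer and n a positive integer. Define polynomials on ℝ^n by g_1(x) := x_1^d and g_i(x) := x_i^d − x_{i−1} for i = 2, …, n. Then each g_i is convex, the set S := {x ∈ ℝ^n : g_i(x) ≤ 0 for all i = 1, …, n} equals {0}, and if c > 0, ε > 0 and τ > 0 are such that dist(x, S) ≤ c·( max_{1 ≤ i ≤ n} [g_i(x)]_+ )^τ for all x with ‖x‖ ≤ ε, then τ ≤ 1/d^n. -/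
open Metric Set
open scoped BigOperators

noncomputable section

/-- A Hölder estimate `t ≤ c * (t ^ N) ^ τ` near `0⁺` forces `N * τ ≤ 1`. -/
theorem mul_le_one_of_eventually_le_mul_rpow {c τ N : ℝ}
    (h : ∀ᶠ t : ℝ in nhdsWithin 0 (Ioi 0), t ≤ c * (t ^ N) ^ τ) : N * τ ≤ 1 := by
  by_contra! hlt
  have hlim : Filter.Tendsto (fun t : ℝ => c * t ^ (N * τ - 1)) (nhdsWithin 0 (Ioi 0))
      (nhds 0) := by
    have hcont := (Real.continuousAt_rpow_const 0 (N * τ - 1) (Or.inr (by linarith))).tendsto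
    rw [Real.zero_rpow (by linarith)] at hcont
    simpa using (hcont.mono_left nhdsWithin_le_nhds).const_mul c
  obtain ⟨t, ⟨ht, hsmall⟩, hpos⟩ :=
    ((h.and (hlim.eventually (gt_mem_nhds one_pos))).and self_mem_nhdsWithin).exists
  have hpos : 0 < t := hpos
  rw [← Real.rpow_mul hpos.le, show N * τ = (N * τ - 1) + 1 by ring,
    Real.rpow_add_one hpos.ne'] at ht
  nlinarith

/-- The curve `t ↦ (t ^ d ^ (n - 1), …, t ^ d, t)`, on which `xᵢ ^ d = xᵢ₋₁`. -/
def powerCurve (n d : ℕ) (t : ℝ) : EuclideanSpace ℝ (Fin n) :=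
  WithLp.toLp 2 fun i => t ^ d ^ (n - 1 - (i : ℕ))

theorem powerCurve_apply (n d : ℕ) (t : ℝ) (i : Fin n) :
    powerCurve n d t i = t ^ d ^ (n - 1 - (i : ℕ)) := rfl

theorem continuous_powerCurve (n d : ℕ) : Continuous (powerCurve n d) := by
  unfold powerCurve
  fun_prop

theorem powerCurve_zero {n d : ℕ} (hd : d ≠ 0) : powerCurve n d 0 = 0 := by
  ext i
  simp [powerCurve_apply, hd]

theorem powerCurve_pow (n d : ℕ) (t : ℝ) (i : Fin n) :
    powerCurve n d t i ^ d = t ^ d ^ (n - (i : ℕ)) := by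
  rw [powerCurve_apply, ← pow_mul, ← pow_succ]
  congr 2
  have := i.isLt
  omega

theorem le_norm_powerCurve {n d : ℕ} (hn : 0 < n) (t : ℝ) : t ≤ ‖powerCurve n d t‖ := by
  have h := PiLp.norm_apply_le (powerCurve n d t) ⟨n - 1, Nat.sub_lt hn one_pos⟩
  rw [powerCurve_apply] at h
  simp only [Nat.sub_self, pow_zero, pow_one] at h
  exact (le_abs_self t).trans h

/-- Example 3.1: for the system `g₁(x) = x₁^d`, `gᵢ(x) = xᵢ^d - x_{i-1}`, the solution
set is `{0}` and any Hölder error-bound exponent `τ` satisfies `τ ≤ 1/dⁿ`. -/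
theorem error_bound_exponent_upper_bound_example
    (n d : ℕ) (hn : 0 < n) (hd : 2 ≤ d) (hdeven : Even d)
    (g : Fin n → EuclideanSpace ℝ (Fin n) → ℝ)
    (hg : ∀ (i : Fin n) (x : EuclideanSpace ℝ (Fin n)),
      g i x = if (i : ℕ) = 0 then x i ^ d
        else x i ^ d - x ⟨(i : ℕ) - 1, lt_of_le_of_lt (Nat.sub_le _ _) i.isLt⟩)
    (S : Set (EuclideanSpace ℝ (Fin n)))
    (hS : S = {x | ∀ i, g i x ≤ 0}) :
    (∀ i, ConvexOn ℝ Set.univ (g i)) ∧ S = {0} ∧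
    ∀ c > (0 : ℝ), ∀ ε > (0 : ℝ), ∀ τ > (0 : ℝ),
      (∀ x : EuclideanSpace ℝ (Fin n), ‖x‖ ≤ ε →
        Metric.infDist x S ≤ c * (⨆ i, max (g i x) 0) ^ τ) →
      τ ≤ 1 / (d : ℝ) ^ n := by
  have hd0 : d ≠ 0 := by omega
  have hSzero : S = {0} := by
    rw [hS]
    refine Subset.antisymm (fun x hx => ?_) ?_
    · have key : ∀ k (hk : k < n), x ⟨k, hk⟩ = 0 := by
        intro k
        induction k with
        | zero =>
          intro hk
          have h := hx ⟨0, hk⟩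
          rw [hg, if_pos rfl] at h
          exact eq_zero_of_pow_eq_zero (le_antisymm h (hdeven.pow_nonneg _))
        | succ k ih =>
          intro hk
          have h := hx ⟨k + 1, hk⟩
          rw [hg, if_neg (Nat.succ_ne_zero k)] at h
          simp only [Nat.add_sub_cancel, ih (by omega), sub_zero] at h
          exact eq_zero_of_pow_eq_zero (le_antisymm h (hdeven.pow_nonneg _))
      rw [mem_singleton_iff]
      ext i
      exact key i i.isLt
    · rintro x rfl i
      rw [hg]
      split_ifs <;> simp [hd0]
  refine ⟨fun i => ?_, hSzero, fun c hc ε hε τ hτ hbound => ?_⟩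
  · have hcoord : ConvexOn ℝ univ fun x : EuclideanSpace ℝ (Fin n) => x i ^ d :=
      hdeven.convexOn_pow.comp_linearMap (EuclideanSpace.proj i).toLinearMap
    by_cases hi : (i : ℕ) = 0
    · rw [show g i = fun x => x i ^ d from funext fun x => by rw [hg, if_pos hi]]
      exact hcoord
    · rw [show g i = _ from funext fun x => by rw [hg, if_neg hi]]
      exact hcoord.sub ((EuclideanSpace.proj _).toLinearMap.concaveOn convex_univ)
  · rw [le_div_iff₀' (by positivity)]
    refine mul_le_one_of_eventually_le_mul_rpow (c := c) ?_
    have hsmall : ∀ᶠ t in nhdsWithin (0 : ℝ) (Ioi 0), ‖powerCurve n d t‖ < ε := by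
      refine nhdsWithin_le_nhds
        ((continuous_powerCurve n d).norm.continuousAt.eventually (gt_mem_nhds ?_))
      simpa [powerCurve_zero hd0] using hε
    filter_upwards [hsmall, self_mem_nhdsWithin] with t hlt hpos
    have hpos : 0 < t := hpos
    have hsup : ⨆ i, max (g i (powerCurve n d t)) 0 ≤ t ^ d ^ n := by
      have : Nonempty (Fin n) := ⟨⟨0, hn⟩⟩
      refine ciSup_le fun i => max_le ?_ (by positivity)
      rw [hg]
      split_ifs with hi
      · rw [powerCurve_pow, hi, Nat.sub_zero]
      · rw [powerCurve_pow, powerCurve_apply,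
          show n - 1 - ((i : ℕ) - 1) = n - (i : ℕ) by omega, sub_self]
        positivity
    calc t ≤ ‖powerCurve n d t‖ := le_norm_powerCurve hn t
      _ = infDist (powerCurve n d t) S := by rw [hSzero, infDist_singleton, dist_zero_right]
      _ ≤ c * (⨆ i, max (g i (powerCurve n d t)) 0) ^ τ := hbound _ hlt.le
      _ ≤ c * (t ^ d ^ n) ^ τ := by
        gcongr
        exact Real.iSup_nonneg fun i => le_max_right _ _
      _ = c * (t ^ ((d : ℝ) ^ n)) ^ τ := by rw [← Nat.cast_pow, Real.rpow_natCast]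
end
end

section
/- Let α ≥ 0 and t_1 > 0, and let (t_k)_{k≥1} be the sequence of real numbers defined by the recursion t_{k+1} = t_k / √((1+α)² + t_k²) for k ≥ 1. Then for every k ≥ 2, t_k = t_1 / √( (1+α)^{2(k−1)} + t_1²·Σ_{i=0}^{k−2} (1+α)^{2i} ). -/
open scoped BigOperators

noncomputable section

/-- Horner-type step for a sum of even powers. -/
theorem sum_range_succ_pow_two_mul (c : ℝ) (n : ℕ) :
    ∑ i ∈ Finset.range (n + 1), c ^ (2 * i) =
      c ^ 2 * ∑ i ∈ Finset.range n, c ^ (2 * i) + 1 := by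
  rw [Finset.sum_range_succ', Finset.mul_sum]
  simp only [mul_add, pow_add, mul_zero, mul_one, pow_zero, mul_comm (c ^ 2)]

/-- Closed form of the recursion `t_{k+1} = t_k / √((1+α)² + t_k²)` (Example 5.2). -/
theorem closed_form_alternating_projection_recursion
    (α : ℝ) (hα : 0 ≤ α) (t : ℕ → ℝ) (ht1 : 0 < t 1)
    (hrec : ∀ k : ℕ, 1 ≤ k → t (k + 1) = t k / Real.sqrt ((1 + α) ^ 2 + t k ^ 2)) :
    ∀ k : ℕ, 2 ≤ k →
      t k = t 1 / Real.sqrt ((1 + α) ^ (2 * (k - 1)) +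
        t 1 ^ 2 * ∑ i ∈ Finset.range (k - 1), (1 + α) ^ (2 * i)) := by
  have key : ∀ n : ℕ, t (n + 1) = t 1 / Real.sqrt ((1 + α) ^ (2 * n) +
      t 1 ^ 2 * ∑ i ∈ Finset.range n, (1 + α) ^ (2 * i)) := by
    have hc : 0 < 1 + α := by linarith
    intro n
    induction n with
    | zero => simp
    | succ n ih =>
      rw [hrec (n + 1) (by omega), ih, sum_range_succ_pow_two_mul]
      set S := ∑ i ∈ Finset.range n, (1 + α) ^ (2 * i)
      have hS0 : 0 ≤ S := Finset.sum_nonneg fun i _ => pow_nonneg hc.le _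
      have hD : 0 < (1 + α) ^ (2 * n) + t 1 ^ 2 * S :=
        add_pos_of_pos_of_nonneg (pow_pos hc _) (mul_nonneg (sq_nonneg _) hS0)
      rw [div_div, ← Real.sqrt_mul hD.le, div_pow, Real.sq_sqrt hD.le]
      congr 2
      field_simp
      ring
  intro k hk
  obtain ⟨n, rfl⟩ : ∃ n, k = n + 1 := ⟨k - 1, by omega⟩
  exact key n
end
end

section
/- Let d ≥ 2 be an even integer and consider the closed convex sets A := {(x, y) ∈ ℝ² : x ≤ 0} and B := {(x, y) ∈ ℝ² : y^d − x ≤ 0} in ℝ². Let b_0 = (x_0, y_0) ∈ ℝ × (0, ∞) with ‖b_0‖ ≤ 1, and define the alternating projection sequences a_{k+1} := P_A(b_k), b_{k+1} := P_B(a_{k+1}) for k ≥ 0; write b_k = (x_k, y_k). Then for every k ≥ 1: y_k > 0, x_k = y_k^d, a_{k+1} = (0, y_k), and d·y_{k+1}^{2d−1} + y_{k+1} = y_k; consequently (y_k) is strictly decreasing and converges to 0. -/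
open Metric Set Filter
open scoped BigOperators

noncomputable section

/-- Comparing distances in the Euclidean plane amounts to comparing sums of squares. -/
lemma EuclideanSpace.dist_le_dist_iff_fin_two (p q r : EuclideanSpace ℝ (Fin 2)) :
    dist p q ≤ dist p r ↔
      (p 0 - q 0) ^ 2 + (p 1 - q 1) ^ 2 ≤ (p 0 - r 0) ^ 2 + (p 1 - r 1) ^ 2 := by
  rw [EuclideanSpace.dist_eq, EuclideanSpace.dist_eq, Real.sqrt_le_sqrt_iff (by positivity)]
  simp [Fin.sum_univ_two, Real.dist_eq, sq_abs]

/-- A nearest point of the half-plane `{x ≤ 0}` has the same second coordinate. -/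
lemma nearest_halfplane_snd {p q : EuclideanSpace ℝ (Fin 2)} (hq : q 0 ≤ 0)
    (hmin : ∀ r : EuclideanSpace ℝ (Fin 2), r 0 ≤ 0 → dist p q ≤ dist p r) : q 1 = p 1 := by
  have h := (EuclideanSpace.dist_le_dist_iff_fin_two _ _ _).1
    (hmin !₂[q 0, p 1] (by simpa using hq))
  simp only [Matrix.cons_val_zero, Matrix.cons_val_one] at h
  have h0 : (p 1 - q 1) ^ 2 = 0 := le_antisymm (by linarith) (sq_nonneg _)
  linarith [pow_eq_zero_iff (two_ne_zero) |>.1 h0]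

/-- A nearest point of the half-plane `{x ≤ 0}` to a point with `0 ≤ x` lies on the boundary. -/
lemma nearest_halfplane_fst {p q : EuclideanSpace ℝ (Fin 2)} (hp : 0 ≤ p 0) (hq : q 0 ≤ 0)
    (hmin : ∀ r : EuclideanSpace ℝ (Fin 2), r 0 ≤ 0 → dist p q ≤ dist p r) : q 0 = 0 := by
  have h := (EuclideanSpace.dist_le_dist_iff_fin_two _ _ _).1 (hmin !₂[0, q 1] (by simp))
  simp only [Matrix.cons_val_zero, Matrix.cons_val_one] at h
  have h0 : q 0 ^ 2 = 0 :=
    le_antisymm (by nlinarith [mul_nonneg hp (neg_nonneg.2 hq)]) (sq_nonneg _)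
  exact pow_eq_zero_iff (two_ne_zero) |>.1 h0

/-- The nearest point `q` of the epigraph `{y ^ d ≤ x}`, with `d` even, to a point `p` of the
quadrant `x ≤ 0 < y`: it lies on the boundary curve, in the upper half-plane, and `q - p` is
normal to the curve. -/
lemma nearest_epigraph_pow {d : ℕ} (hd : 2 ≤ d) (hdeven : Even d)
    {p q : EuclideanSpace ℝ (Fin 2)} (hp0 : p 0 ≤ 0) (hp1 : 0 < p 1) (hq : q 1 ^ d - q 0 ≤ 0)
    (hmin : ∀ r : EuclideanSpace ℝ (Fin 2), r 1 ^ d - r 0 ≤ 0 → dist p q ≤ dist p r) :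
    0 < q 1 ∧ q 0 = q 1 ^ d ∧ (q 1 ^ d - p 0) * (d * q 1 ^ (d - 1)) + q 1 = p 1 := by
  have hpow : 0 ≤ q 1 ^ d := hdeven.pow_nonneg _
  have key (t : ℝ) :
      (p 0 - q 0) ^ 2 + (p 1 - q 1) ^ 2 ≤ (p 0 - t ^ d) ^ 2 + (p 1 - t) ^ 2 := by
    have h := (EuclideanSpace.dist_le_dist_iff_fin_two _ _ _).1 (hmin !₂[t ^ d, t] (by simp))
    simpa only [PiLp.toLp_apply, Matrix.cons_val_zero, Matrix.cons_val_one] using h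
  have hfst : q 0 = q 1 ^ d := by
    refine le_antisymm ?_ (by linarith)
    have h : (q 0 - p 0) ^ 2 ≤ (q 1 ^ d - p 0) ^ 2 := by linarith [key (q 1)]
    linarith [(sq_le_sq₀ (by linarith) (by linarith)).1 h]
  have hderiv : HasDerivAt (fun t : ℝ => (t ^ d - p 0) ^ 2 + (t - p 1) ^ 2)
      (2 * (q 1 ^ d - p 0) * (d * q 1 ^ (d - 1)) + 2 * (q 1 - p 1)) (q 1) := by
    have h := (((hasDerivAt_pow d (q 1)).sub_const (p 0)).pow 2).add
      (((hasDerivAt_id (q 1)).sub_const (p 1)).pow 2)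
    refine (h.congr_deriv (by simp)).congr_of_eventuallyEq (Eventually.of_forall fun t => ?_)
    simp
  have hcrit : 2 * (q 1 ^ d - p 0) * (d * q 1 ^ (d - 1)) + 2 * (q 1 - p 1) = 0 := by
    refine IsLocalMin.hasDerivAt_eq_zero (Eventually.of_forall fun t => ?_) hderiv
    have h := key t
    rw [hfst] at h
    linarith
  refine ⟨?_, hfst, by linarith⟩
  by_contra! hneg
  have hodd : Odd (d - 1) := Nat.Even.sub_odd (by omega) hdeven odd_one
  have h1 : q 1 ^ (d - 1) ≤ 0 := hodd.pow_nonpos_iff.2 hneg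
  have h2 : (q 1 ^ d - p 0) * (d * q 1 ^ (d - 1)) ≤ 0 :=
    mul_nonpos_of_nonneg_of_nonpos (by linarith)
      (mul_nonpos_of_nonneg_of_nonpos (Nat.cast_nonneg d) h1)
  linarith

/-- A nonnegative sequence with `c * y (k + 1) ^ n + y (k + 1) = y k` and `c > 0` tends to `0`. -/
lemma tendsto_zero_of_mul_pow_add_eq {c : ℝ} (hc : 0 < c) {n : ℕ} {y : ℕ → ℝ}
    (hy : ∀ k, 0 ≤ y k) (hrec : ∀ k, c * y (k + 1) ^ n + y (k + 1) = y k) :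
    Tendsto y atTop (nhds 0) := by
  have hanti : Antitone y := antitone_nat_of_succ_le fun k => by
    linarith [hrec k, mul_nonneg hc.le (pow_nonneg (hy (k + 1)) n)]
  have hlim := tendsto_atTop_ciInf hanti ⟨0, by rintro _ ⟨k, rfl⟩; exact hy k⟩
  set L := ⨅ k, y k
  have hshift := hlim.comp (tendsto_add_atTop_nat 1)
  have hL : c * L ^ n + L = L :=
    tendsto_nhds_unique ((((hshift.pow n).const_mul c).add hshift).congr hrec) hlim
  have hL0 : L = 0 := by
    have h : c * L ^ n = 0 := by linarith
    exact eq_zero_of_pow_eq_zero ((mul_eq_zero.1 h).resolve_left hc.ne')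
  rwa [hL0] at hlim

/-- Example 5.6: alternating projections between `A = {x ≤ 0}` and
`B = {y^d - x ≤ 0}` in the plane. -/
theorem alternating_projection_halfplane_polynomial_example
    (d : ℕ) (hd : 2 ≤ d) (hdeven : Even d)
    (A B : Set (EuclideanSpace ℝ (Fin 2)))
    (hA : A = {p : EuclideanSpace ℝ (Fin 2) | p 0 ≤ 0})
    (hB : B = {p : EuclideanSpace ℝ (Fin 2) | p 1 ^ d - p 0 ≤ 0})
    (a b : ℕ → EuclideanSpace ℝ (Fin 2))
    (hb0pos : 0 < b 0 1) (hb0norm : ‖b 0‖ ≤ 1)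
    -- the alternating projection sequences: `a (k+1)` is the nearest point of `A`
    -- to `b k`, and `b (k+1)` is the nearest point of `B` to `a (k+1)`
    (ha : ∀ k : ℕ, a (k + 1) ∈ A ∧ ∀ y ∈ A, dist (b k) (a (k + 1)) ≤ dist (b k) y)
    (hb : ∀ k : ℕ, b (k + 1) ∈ B ∧
      ∀ y ∈ B, dist (a (k + 1)) (b (k + 1)) ≤ dist (a (k + 1)) y) :
    (∀ k : ℕ, 1 ≤ k →
      0 < b k 1 ∧ b k 0 = b k 1 ^ d ∧
      a (k + 1) 0 = 0 ∧ a (k + 1) 1 = b k 1 ∧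
      (d : ℝ) * b (k + 1) 1 ^ (2 * d - 1) + b (k + 1) 1 = b k 1) ∧
    (∀ k : ℕ, 1 ≤ k → b (k + 1) 1 < b k 1) ∧
    Tendsto (fun k => b k 1) atTop (nhds 0) := by
  subst hA hB
  simp only [mem_ofPred_eq] at ha hb
  have ha1 (k : ℕ) : a (k + 1) 1 = b k 1 := nearest_halfplane_snd (ha k).1 (ha k).2
  have hstep (k : ℕ) (hk : 0 < b k 1) :=
    nearest_epigraph_pow hd hdeven (ha k).1 ((ha1 k).symm ▸ hk) (hb k).1 (hb k).2
  have hpos (k : ℕ) : 0 < b k 1 := by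
    induction k with
    | zero => exact hb0pos
    | succ k ih => exact (hstep k ih).1
  have hcurve (k : ℕ) : b (k + 1) 0 = b (k + 1) 1 ^ d := (hstep k (hpos k)).2.1
  have ha0 (k : ℕ) : a (k + 1 + 1) 0 = 0 :=
    nearest_halfplane_fst (hcurve k ▸ hdeven.pow_nonneg _) (ha (k + 1)).1 (ha (k + 1)).2
  have hrec (k : ℕ) :
      (d : ℝ) * b (k + 1 + 1) 1 ^ (2 * d - 1) + b (k + 1 + 1) 1 = b (k + 1) 1 := by
    have h := (hstep (k + 1) (hpos (k + 1))).2.2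
    rw [ha0, ha1] at h
    rw [show 2 * d - 1 = d + (d - 1) by omega, pow_add]
    linarith
  have hdpos : (0 : ℝ) < d := by exact_mod_cast (by omega : 0 < d)
  refine ⟨?_, ?_, ?_⟩
  · rintro (_ | k) hk
    · omega
    · exact ⟨hpos _, hcurve k, ha0 k, ha1 _, hrec k⟩
  · rintro (_ | k) hk
    · omega
    · linarith [hrec k, mul_pos hdpos (pow_pos (hpos (k + 1 + 1)) (2 * d - 1))]
  · exact (tendsto_add_atTop_iff_nat 1).1
      (tendsto_zero_of_mul_pow_add_eq hdpos (fun k => (hpos (k + 1)).le) hrec)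
end
end
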